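/- arXiv:1607.01733 — 4 statements merged into one kernel-verified Lean document; each statement's English description precedes it below -/
import Mathlib

section
/- Let n ≥ 1, let g ∈ ℝⁿ be the all-ones vector, and let A = Σ_{k=0}^{n−1} Z^k (g gᵀ) (Zᵀ)^k (equivalently, A is the unique matrix with ∇(A) = g gᵀ; its entries are A_{ij} = min(i,j)). Then ‖A‖₂ ≥ √(2/15)·n². In particular, since ‖∇(A)‖₂ = ‖g gᵀ‖₂ = n, the ratio ‖A‖₂ / ‖∇(A)‖₂ ≥ √(2/15)·n grows linearly with n, so the factor n in the upper bound ‖A‖₂ ≤ n‖∇(A)‖₂ cannot be replaced by anything of smaller order. -/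
open Matrix

noncomputable section

/-- The `n × n` downward shift matrix (ones on the first subdiagonal), over `ℝ`. -/
def ZmatR (n : ℕ) : Matrix (Fin n) (Fin n) ℝ :=
  Matrix.of fun i j => if (i : ℕ) = (j : ℕ) + 1 then 1 else 0

/-- The displacement `∇(A) = A - Z A Zᴴ` (over `ℝ`, `Zᴴ = Zᵀ`). -/
def dispR {n : ℕ} (A : Matrix (Fin n) (Fin n) ℝ) : Matrix (Fin n) (Fin n) ℝ :=
  A - ZmatR n * A * (ZmatR n)ᴴ

/-- The spectral (operator 2-) norm of a real matrix. -/
def spectralNormR {n : ℕ} (A : Matrix (Fin n) (Fin n) ℝ) : ℝ :=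
  ‖Matrix.toEuclideanCLM (𝕜 := ℝ) A‖

theorem ZmatR_mulVec_apply {n : ℕ} (v : Fin n → ℝ) (i : Fin n) :
    (ZmatR n *ᵥ v) i = ∑ j : Fin n, if (i : ℕ) = (j : ℕ) + 1 then v j else 0 := by
  simp [Matrix.mulVec, dotProduct, ZmatR]

theorem ZmatR_pow_mulVec_one {n : ℕ} (k : ℕ) :
    ZmatR n ^ k *ᵥ (1 : Fin n → ℝ) = fun i : Fin n => if k ≤ (i : ℕ) then 1 else 0 := by
  induction k with
  | zero => ext i; simp
  | succ k ih =>
    ext i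
    rw [pow_succ', ← Matrix.mulVec_mulVec, ih, ZmatR_mulVec_apply]
    split_ifs with h
    · rw [Finset.sum_eq_single (⟨i - 1, by omega⟩ : Fin n)]
      · rw [if_pos (by simp; omega), if_pos (by simp; omega)]
      · intro j _ hj
        rw [if_neg]
        intro h'
        exact hj (Fin.ext (by simp; omega))
      · simp
    · refine Finset.sum_eq_zero fun j _ => ?_
      split_ifs <;> first | rfl | omega

theorem pow_mul_vecMulVec_mul_conjTranspose_pow {n : ℕ} (Z : Matrix (Fin n) (Fin n) ℝ)
    (v : Fin n → ℝ) (k : ℕ) :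
    Z ^ k * Matrix.vecMulVec v v * Zᴴ ^ k = Matrix.vecMulVec (Z ^ k *ᵥ v) (Z ^ k *ᵥ v) := by
  rw [← Matrix.conjTranspose_pow, Matrix.mul_vecMulVec, Matrix.vecMulVec_mul,
    Matrix.conjTranspose_eq_transpose_of_trivial, Matrix.vecMul_transpose]

/-- Conjugating by `Z` shifts the defining sum by one term, so the displacement telescopes. -/
theorem dispR_sum {n : ℕ} (v : Fin n → ℝ) (m : ℕ) :
    dispR (∑ k ∈ Finset.range m, ZmatR n ^ k * Matrix.vecMulVec v v * (ZmatR n)ᴴ ^ k) =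
      Matrix.vecMulVec v v - Matrix.vecMulVec (ZmatR n ^ m *ᵥ v) (ZmatR n ^ m *ᵥ v) := by
  have h : ∀ k, ZmatR n * (ZmatR n ^ k * Matrix.vecMulVec v v * (ZmatR n)ᴴ ^ k) * (ZmatR n)ᴴ =
      ZmatR n ^ (k + 1) * Matrix.vecMulVec v v * (ZmatR n)ᴴ ^ (k + 1) := fun k => by
    rw [pow_succ', pow_succ]
    simp only [mul_assoc]
  rw [dispR, Finset.mul_sum, Finset.sum_mul]
  simp only [h]
  rw [← Finset.sum_sub_distrib, Finset.sum_range_sub']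
  simp only [pow_mul_vecMulVec_mul_conjTranspose_pow, pow_zero, one_mul, mul_one]

theorem spectralNormR_vecMulVec {n : ℕ} (u v : Fin n → ℝ) :
    spectralNormR (Matrix.vecMulVec u v) = ‖WithLp.toLp 2 u‖ * ‖WithLp.toLp 2 v‖ := by
  rw [← InnerProductSpace.norm_rankOne (𝕜 := ℝ), spectralNormR]
  congr 1
  ext x i
  simp [Matrix.vecMulVec_mulVec, InnerProductSpace.rankOne_apply, PiLp.inner_apply,
    dotProduct, Matrix.ofLp_toEuclideanCLM, mul_comm]

theorem sum_pow_mul_vecMulVec_one_mulVec {n : ℕ} (i : Fin n) :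
    ((∑ k ∈ Finset.range n, ZmatR n ^ k * Matrix.vecMulVec 1 1 * (ZmatR n)ᴴ ^ k) *ᵥ 1) i =
      (n : ℝ) * (i + 1) - i * (i + 1) / 2 := by
  have hdot : ∀ k ∈ Finset.range n,
      (fun j : Fin n => if k ≤ (j : ℕ) then (1 : ℝ) else 0) ⬝ᵥ 1 = n - k := fun k hk => by
    rw [Finset.mem_range] at hk
    simp only [dotProduct, Pi.one_apply, mul_one]
    rw [Fin.sum_univ_eq_sum_range (fun j => if k ≤ j then (1 : ℝ) else 0), ← Finset.sum_filter,
      Finset.sum_const, nsmul_one, ← Nat.cast_sub hk.le]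
    have : (Finset.range n).filter (k ≤ ·) = Finset.Ico k n := by ext; simp [and_comm]
    rw [this, Nat.card_Ico]
  have hsum : ∀ m : ℕ, ∑ k ∈ Finset.range (m + 1), ((n : ℝ) - k) =
      (n : ℝ) * (m + 1) - m * (m + 1) / 2 := fun m => by
    induction m with
    | zero => simp
    | succ m ih => rw [Finset.sum_range_succ, ih]; push_cast; ring
  simp only [pow_mul_vecMulVec_mul_conjTranspose_pow, ZmatR_pow_mulVec_one]
  rw [Matrix.sum_mulVec, Finset.sum_apply, ← hsum]
  simp only [Matrix.vecMulVec_mulVec]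
  have hsub : Finset.range (i + 1) ⊆ Finset.range n := by
    simp
  rw [← Finset.sum_subset hsub]
  · refine Finset.sum_congr rfl fun k hk => ?_
    have hki : k ≤ (i : ℕ) := Nat.lt_succ_iff.mp (Finset.mem_range.mp hk)
    simp [hdot k (hsub hk), hki]
  · intro k _ hk
    have hki : ¬ k ≤ (i : ℕ) := fun h => hk (Finset.mem_range.mpr (Nat.lt_succ_of_le h))
    simp [hki]

theorem sum_range_sq_quadratic (a : ℝ) (m : ℕ) :
    ∑ i ∈ Finset.range m, (a * (i + 1) - i * (i + 1) / 2) ^ 2 =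
      a ^ 2 * (m * (m + 1) * (2 * m + 1) / 6) - a * ((m - 1) * m * (m + 1) * (3 * m + 2) / 12) +
        (m - 1) * m * (m + 1) * (3 * m ^ 2 - 2) / 60 := by
  induction m with
  | zero => simp
  | succ k ih => rw [Finset.sum_range_succ, ih]; push_cast; ring

theorem norm_toLp_one_sq (n : ℕ) : ‖WithLp.toLp 2 (1 : Fin n → ℝ)‖ ^ 2 = n := by
  simp [EuclideanSpace.real_norm_sq_eq]

theorem displacement_upper_bound_sharp (n : ℕ) (hn : 1 ≤ n)
    (g : Fin n → ℝ) (hg : ∀ i, g i = 1)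
    (A : Matrix (Fin n) (Fin n) ℝ)
    (hA : A = ∑ k ∈ Finset.range n,
      ZmatR n ^ k * Matrix.vecMulVec g g * ((ZmatR n)ᴴ) ^ k) :
    Real.sqrt (2 / 15) * (n : ℝ) ^ 2 ≤ spectralNormR A ∧
    spectralNormR (dispR A) = (n : ℝ) ∧
    Real.sqrt (2 / 15) * (n : ℝ) * spectralNormR (dispR A) ≤ spectralNormR A := by
  obtain rfl : g = 1 := funext hg
  have hdisp : spectralNormR (dispR A) = n := by
    have hz : ZmatR n ^ n *ᵥ (1 : Fin n → ℝ) = 0 := by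
      rw [ZmatR_pow_mulVec_one]
      ext i
      simp
    rw [hA, dispR_sum, hz, Matrix.zero_vecMulVec, sub_zero, spectralNormR_vecMulVec, ← sq,
      norm_toLp_one_sq]
  have hmain : Real.sqrt (2 / 15) * (n : ℝ) ^ 2 ≤ spectralNormR A := by
    have hpos : (0 : ℝ) < n := by exact_mod_cast hn
    have hle := (Matrix.toEuclideanCLM (𝕜 := ℝ) A).le_opNorm (WithLp.toLp 2 1)
    rw [← spectralNormR] at hle
    have hsq := pow_le_pow_left₀ (norm_nonneg _) hle 2
    rw [mul_pow, norm_toLp_one_sq, EuclideanSpace.real_norm_sq_eq] at hsq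
    simp only [Matrix.toEuclideanCLM_toLp, hA, sum_pow_mul_vecMulVec_one_mulVec] at hsq
    rw [← hA, Fin.sum_univ_eq_sum_range (fun i => ((n : ℝ) * (i + 1) - i * (i + 1) / 2) ^ 2),
      sum_range_sq_quadratic] at hsq
    refine (abs_le_of_sq_le_sq' ?_ (norm_nonneg _)).2
    rw [mul_pow, Real.sq_sqrt (by norm_num)]
    refine le_of_mul_le_mul_right (le_trans ?_ hsq) hpos
    have : (0 : ℝ) ≤ n ^ 4 / 3 + n ^ 3 / 3 + n ^ 2 / 6 + n / 30 := by positivity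
    linarith
  refine ⟨hmain, hdisp, ?_⟩
  rw [hdisp]
  linarith

end
end

section
/- (Generator block update.) Let F ∈ ℂ^{n×n} be strictly lower triangular and write F = [[F̂, 0],[⋆, F₁]] in block form with F̂ ∈ ℂ^{k×k} and F₁ ∈ ℂ^{(n−k)×(n−k)}. Let M = [[D, U],[L, M₁]] ∈ ℂ^{n×n} with D ∈ ℂ^{k×k} invertible, and suppose M − F M Fᴴ = G Bᴴ for G, B ∈ ℂ^{n×r}; write G = [Ĝ; ⋆] and B = [B̂; ⋆] with Ĝ, B̂ ∈ ℂ^{k×r} the top k rows. Then the matrices G + (F − Iₙ)·[D; L]·D^{-1}·(I_k − F̂)^{-1}·Ĝ and B + (F − Iₙ)·[Dᴴ; Uᴴ]·(Dᴴ)^{-1}·(I_k − F̂)^{-1}·B̂ have their first k rows equal to zero, and, denoting their bottom (n−k)×r blocks by G₁ and B₁ respectively, the Schur complement S = M₁ − L D^{-1} U satisfies S − F₁ S F₁ᴴ = G₁ B₁ᴴ. -/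
open Matrix

noncomputable section

/-- If `N` is strictly lower triangular then `1 - N` has invertible determinant. -/
theorem isUnit_det_one_sub_of_strictly_lower {n R : Type*} [Fintype n] [LinearOrder n] [CommRing R]
    (N : Matrix n n R) (hN : ∀ i j, i ≤ j → N i j = 0) : IsUnit (1 - N).det := by
  have h : (1 - N).det = ∏ i, (1 - N) i i := by
    refine det_of_isLowerTriangular _ fun i j hij => ?_
    have hlt : i < j := by simpa using hij
    simp [hN i j hlt.le, one_apply_ne hlt.ne]
  simp [h, hN _ _ le_rfl]

/-- The Schur complement displacement identity, with the adjoints replaced by independent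
matrices. Here `E` inverts `D`, `P` inverts `1 - f` and `Q` inverts `1 - f'`. -/
theorem schur_displacement {k m r R : Type*} [Fintype k] [Fintype m] [Fintype r]
    [DecidableEq k] [DecidableEq m] [CommRing R]
    {f f' D E P Q : Matrix k k R} {F21 L : Matrix m k R} {F21' U : Matrix k m R}
    {F1 F1' M : Matrix m m R}
    {g : Matrix k r R} {g₂ : Matrix m r R} {b : Matrix r k R} {b₂ : Matrix r m R}
    (hDE : D * E = 1) (hED : E * D = 1) (hP : P * f = P - 1) (hQ : f' * Q = Q - 1)
    (h11 : D - f * D * f' = g * b)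
    (h12 : U - f * (D * F21' + U * F1') = g * b₂)
    (h21 : L - (F21 * D + F1 * L) * f' = g₂ * b)
    (h22 : M - ((F21 * D + F1 * L) * F21' + (F21 * U + F1 * M) * F1') = g₂ * b₂) :
    (M - L * E * U) - F1 * (M - L * E * U) * F1' =
      (g₂ + (F21 * D + (F1 - 1) * L) * E * P * g) *
        (b₂ + b * Q * E * (D * F21' + U * (F1' - 1))) := by
  obtain ⟨X, hX⟩ : ∃ X, X = F21 + (F1 - 1) * L * E := ⟨_, rfl⟩
  obtain ⟨Y, hY⟩ : ∃ Y, Y = F21' + E * U * (F1' - 1) := ⟨_, rfl⟩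
  have hXE : (F21 * D + (F1 - 1) * L) * E = X := by
    rw [hX, Matrix.add_mul, Matrix.mul_assoc F21, hDE, Matrix.mul_one]
  have hYE : E * (D * F21' + U * (F1' - 1)) = Y := by
    rw [hY, Matrix.mul_add, ← Matrix.mul_assoc E D, hED, Matrix.one_mul, Matrix.mul_assoc]
  have hXD : F21 * D + F1 * L = X * D + L := by
    rw [hX, Matrix.add_mul, Matrix.mul_assoc _ E, hED, Matrix.mul_one, Matrix.sub_mul,
      Matrix.one_mul]
    abel
  have hYD : D * F21' + U * F1' = D * Y + U := by
    rw [hY, Matrix.mul_add, Matrix.mul_assoc E, ← Matrix.mul_assoc D E, hDE, Matrix.one_mul,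
      Matrix.mul_sub, Matrix.mul_one]
    abel
  have e21 : g₂ * b * Q = L - X * D * (Q - 1) := by
    rw [← h21, hXD, Matrix.sub_mul, Matrix.mul_assoc _ f', hQ]
    simp only [Matrix.add_mul, Matrix.mul_sub, Matrix.mul_one]
    abel
  have e12 : P * (g * b₂) = U - (P - 1) * (D * Y) := by
    rw [← h12, hYD, Matrix.mul_sub, ← Matrix.mul_assoc P f, hP]
    simp only [Matrix.mul_add, Matrix.sub_mul, Matrix.one_mul]
    abel
  have e11 : P * (g * b) * Q = P * D + D * Q - D := by
    have : P * (f * D * f') * Q = (P * f) * D * (f' * Q) := by simp only [Matrix.mul_assoc]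
    rw [← h11, Matrix.mul_sub, Matrix.sub_mul, this, hP, hQ]
    noncomm_ring
  have key : (g₂ + X * P * g) * (b₂ + b * Q * Y) = g₂ * b₂ + L * Y + X * U + X * D * Y := by
    calc (g₂ + X * P * g) * (b₂ + b * Q * Y)
        = g₂ * b₂ + (g₂ * b * Q) * Y + X * (P * (g * b₂)) + X * (P * (g * b) * Q) * Y := by
          simp only [Matrix.add_mul, Matrix.mul_add, Matrix.mul_assoc]
          abel
      _ = _ := by
          rw [e21, e12, e11]
          simp only [Matrix.add_mul, Matrix.mul_add, Matrix.sub_mul, Matrix.mul_sub,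
            Matrix.one_mul, Matrix.mul_one, Matrix.mul_assoc]
          abel
  have hDE' (Z : Matrix k m R) : D * (E * Z) = Z := by
    rw [← Matrix.mul_assoc, hDE, Matrix.one_mul]
  have hED' (Z : Matrix k m R) : E * (D * Z) = Z := by
    rw [← Matrix.mul_assoc, hED, Matrix.one_mul]
  rw [hXE, Matrix.mul_assoc (b * Q) E, hYE, key, ← h22, hX, hY]
  simp only [Matrix.add_mul, Matrix.mul_add, Matrix.sub_mul, Matrix.mul_sub,
    Matrix.one_mul, Matrix.mul_one, Matrix.mul_assoc, hDE', hED']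
  abel

/-- The upper block of the updated generator vanishes. -/
theorem generator_update_toRows₁ {k r R : Type*} [Fintype k] [DecidableEq k] [CommRing R]
    {f D : Matrix k k R} (hD : IsUnit D.det) (hf : IsUnit (1 - f).det) (g : Matrix k r R) :
    g + (f - 1) * D * D⁻¹ * (1 - f)⁻¹ * g = 0 := by
  rw [mul_nonsing_inv_cancel_right _ _ hD, ← neg_sub 1 f, Matrix.neg_mul,
    mul_nonsing_inv _ hf, Matrix.neg_mul, Matrix.one_mul, add_neg_cancel]

/-- Generator block update (Schur complement): if `M - F M Fᴴ = G Bᴴ` with `F` strictly lower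
triangular (block form `[[F̂, 0], [F₂₁, F₁]]`), then the displayed updates of `G` and `B` have
vanishing first `k` rows, and their bottom blocks generate the Schur complement
`S = M₁ - L D⁻¹ U` with respect to `F₁`. -/
theorem generator_block_update (k m r : ℕ)
    (Fhat : Matrix (Fin k) (Fin k) ℂ) (F21 : Matrix (Fin m) (Fin k) ℂ)
    (F1 : Matrix (Fin m) (Fin m) ℂ)
    (hFhat : ∀ i j : Fin k, i ≤ j → Fhat i j = 0)
    (hF1 : ∀ i j : Fin m, i ≤ j → F1 i j = 0)
    (D : Matrix (Fin k) (Fin k) ℂ) (U : Matrix (Fin k) (Fin m) ℂ)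
    (L : Matrix (Fin m) (Fin k) ℂ) (M₁ : Matrix (Fin m) (Fin m) ℂ)
    (hD : IsUnit D.det)
    (G B : Matrix (Fin k ⊕ Fin m) (Fin r) ℂ)
    (hGB : Matrix.fromBlocks D U L M₁ -
        Matrix.fromBlocks Fhat 0 F21 F1 * Matrix.fromBlocks D U L M₁ *
          (Matrix.fromBlocks Fhat 0 F21 F1)ᴴ = G * Bᴴ) :
    let F := Matrix.fromBlocks Fhat 0 F21 F1
    let Ghat : Matrix (Fin k) (Fin r) ℂ := G.submatrix Sum.inl id
    let Bhat : Matrix (Fin k) (Fin r) ℂ := B.submatrix Sum.inl id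
    let G' := G + (F - 1) * Matrix.fromRows D L * D⁻¹ * (1 - Fhat)⁻¹ * Ghat
    let B' := B + (F - 1) * Matrix.fromRows Dᴴ Uᴴ * (Dᴴ)⁻¹ * (1 - Fhat)⁻¹ * Bhat
    let S := M₁ - L * D⁻¹ * U
    (∀ (i : Fin k) (j : Fin r), G' (Sum.inl i) j = 0) ∧
    (∀ (i : Fin k) (j : Fin r), B' (Sum.inl i) j = 0) ∧
    S - F1 * S * F1ᴴ = (G'.submatrix Sum.inr id) * (B'.submatrix Sum.inr id)ᴴ := by
  intro F Ghat Bhat G' B' S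
  have hf := isUnit_det_one_sub_of_strictly_lower Fhat hFhat
  have hDH : IsUnit Dᴴ.det := by rw [det_conjTranspose]; exact hD.star
  have hF : F - 1 = fromBlocks (Fhat - 1) 0 F21 (F1 - 1) := by
    rw [← fromBlocks_one, sub_eq_add_neg, fromBlocks_neg, fromBlocks_add]
    simp [sub_eq_add_neg]
  obtain ⟨g₂, hG⟩ : ∃ g₂, G = fromRows Ghat g₂ := ⟨G.toRows₂, (fromRows_toRows G).symm⟩
  obtain ⟨b₂, hB⟩ : ∃ b₂, B = fromRows Bhat b₂ := ⟨B.toRows₂, (fromRows_toRows B).symm⟩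
  have hG' : G' = fromRows 0
      (g₂ + (F21 * D + (F1 - 1) * L) * D⁻¹ * (1 - Fhat)⁻¹ * Ghat) := by
    rw [← generator_update_toRows₁ hD hf Ghat]
    simp only [G', hF, fromBlocks_mul_fromRows, fromRows_mul, Matrix.zero_mul, add_zero]
    conv_lhs => rw [hG]
    ext (i | i) j <;> simp
  have hB' : B' = fromRows 0
      (b₂ + (F21 * Dᴴ + (F1 - 1) * Uᴴ) * Dᴴ⁻¹ * (1 - Fhat)⁻¹ * Bhat) := by
    rw [← generator_update_toRows₁ hDH hf Bhat]
    simp only [B', hF, fromBlocks_mul_fromRows, fromRows_mul, Matrix.zero_mul, add_zero]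
    conv_lhs => rw [hB]
    ext (i | i) j <;> simp
  refine ⟨fun i j => by simp [hG'], fun i j => by simp [hB'], ?_⟩
  have hblocks : fromBlocks D U L M₁ - fromBlocks Fhat 0 F21 F1 * fromBlocks D U L M₁ *
      (fromBlocks Fhat 0 F21 F1)ᴴ = fromRows Ghat g₂ * (fromRows Bhat b₂)ᴴ := by
    rw [hGB, ← hG, ← hB]
  rw [fromBlocks_conjTranspose, conjTranspose_fromRows_eq_fromCols_conjTranspose,
    fromRows_mul_fromCols, fromBlocks_multiply, fromBlocks_multiply, sub_eq_add_neg,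
    fromBlocks_neg, fromBlocks_add, fromBlocks_inj] at hblocks
  simp only [conjTranspose_zero, Matrix.zero_mul, Matrix.mul_zero, add_zero,
    ← sub_eq_add_neg] at hblocks
  obtain ⟨h11, h12, h21, h22⟩ := hblocks
  have hP : (1 - Fhat)⁻¹ * Fhat = (1 - Fhat)⁻¹ - 1 := by
    have h := nonsing_inv_mul _ hf
    rw [Matrix.mul_sub, Matrix.mul_one] at h
    exact eq_sub_of_add_eq (sub_eq_iff_eq_add'.mp h).symm
  have hQ : Fhatᴴ * ((1 - Fhat)⁻¹)ᴴ = ((1 - Fhat)⁻¹)ᴴ - 1 := by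
    rw [← conjTranspose_mul, hP, conjTranspose_sub, conjTranspose_one]
  have h12' : U - Fhat * (D * F21ᴴ + U * F1ᴴ) = Ghat * b₂ᴴ := by
    rw [← h12, Matrix.mul_add, Matrix.mul_assoc, Matrix.mul_assoc]
  have key := schur_displacement (mul_nonsing_inv _ hD) (nonsing_inv_mul _ hD) hP hQ
    h11 h12' h21 h22
  have hG₂ : G'.submatrix Sum.inr id =
      g₂ + (F21 * D + (F1 - 1) * L) * D⁻¹ * (1 - Fhat)⁻¹ * Ghat := by
    rw [hG']; rfl
  have hB₂ : (B'.submatrix Sum.inr id)ᴴ =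
      b₂ᴴ + Bhatᴴ * ((1 - Fhat)⁻¹)ᴴ * D⁻¹ * (D * F21ᴴ + U * (F1ᴴ - 1)) := by
    have : B'.submatrix Sum.inr id =
        b₂ + (F21 * Dᴴ + (F1 - 1) * Uᴴ) * Dᴴ⁻¹ * (1 - Fhat)⁻¹ * Bhat := by
      rw [hB']; rfl
    rw [this, ← conjTranspose_nonsing_inv D]
    simp only [conjTranspose_add, conjTranspose_mul, conjTranspose_sub, conjTranspose_one,
      conjTranspose_conjTranspose, Matrix.mul_assoc]
  rw [hG₂, hB₂]
  exact key

end
end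

section
/- Let T ∈ ℂ^{n×n} be a Toeplitz matrix and let p be a polynomial of degree at most s (s ≥ 1). Then p(T) has displacement rank at most 2s, i.e., rank(p(T) − Z p(T) Zᴴ) ≤ 2s. -/
open Matrix

noncomputable section

/-- The `n × n` downward shift matrix (ones on the first subdiagonal). -/
def Zmat (n : ℕ) : Matrix (Fin n) (Fin n) ℂ :=
  Matrix.of fun i j => if (i : ℕ) = (j : ℕ) + 1 then 1 else 0

/-- The displacement `∇(A) = A - Z A Zᴴ`. -/
def disp {n : ℕ} (A : Matrix (Fin n) (Fin n) ℂ) : Matrix (Fin n) (Fin n) ℂ :=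
  A - Zmat n * A * (Zmat n)ᴴ

lemma rank_add_le_rank_add_rank {m n : ℕ} (A B : Matrix (Fin m) (Fin n) ℂ) :
    (A + B).rank ≤ A.rank + B.rank := by
  unfold Matrix.rank
  rw [mulVecLin_add]
  exact (Submodule.finrank_mono (LinearMap.range_add_le _ _)).trans
    (Submodule.finrank_add_le_finrank_add_finrank _ _)

lemma rank_sum_vecMulVec_le {n : ℕ} (s : ℕ) (u w : ℕ → Fin n → ℂ) :
    (∑ i ∈ Finset.range s, vecMulVec (u i) (w i)).rank ≤ s := by
  induction s with
  | zero => simp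
  | succ s ih =>
    rw [Finset.sum_range_succ]
    exact (rank_add_le_rank_add_rank _ _).trans (add_le_add ih (rank_vecMulVec_le _ _))

lemma Zmat_mul_zero {n : ℕ} (A : Matrix (Fin (n + 1)) (Fin (n + 1)) ℂ) (j : Fin (n + 1)) :
    (Zmat (n + 1) * A) 0 j = 0 := by
  simp [Matrix.mul_apply, Zmat]

lemma Zmat_mul_succ {n : ℕ} (A : Matrix (Fin (n + 1)) (Fin (n + 1)) ℂ) (i : Fin n)
    (j : Fin (n + 1)) : (Zmat (n + 1) * A) i.succ j = A i.castSucc j := by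
  rw [Matrix.mul_apply, Finset.sum_eq_single i.castSucc]
  · simp [Zmat]
  · intro k _ hk
    have : (i : ℕ) ≠ k := fun h => hk (Fin.ext h.symm)
    simp [Zmat, this]
  · simp

lemma mul_Zmat_last {n : ℕ} (A : Matrix (Fin (n + 1)) (Fin (n + 1)) ℂ) (i : Fin (n + 1)) :
    (A * Zmat (n + 1)) i (Fin.last n) = 0 := by
  rw [Matrix.mul_apply]
  refine Finset.sum_eq_zero fun k _ => ?_
  have : (k : ℕ) ≠ n + 1 := by omega
  simp [Zmat, this]

lemma mul_Zmat_castSucc {n : ℕ} (A : Matrix (Fin (n + 1)) (Fin (n + 1)) ℂ) (i : Fin (n + 1))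
    (j : Fin n) : (A * Zmat (n + 1)) i j.castSucc = A i j.succ := by
  rw [Matrix.mul_apply, Finset.sum_eq_single j.succ]
  · simp [Zmat]
  · intro k _ hk
    have : (k : ℕ) ≠ j + 1 := fun h => hk (Fin.ext h)
    simp [Zmat, this]
  · simp

lemma Zmat_mul_conjTranspose (n : ℕ) :
    Zmat (n + 1) * (Zmat (n + 1))ᴴ =
      1 - vecMulVec (Pi.single (0 : Fin (n + 1)) 1) (Pi.single 0 1) := by
  ext i j
  refine Fin.cases ?_ (fun i => ?_) i
  · rw [Zmat_mul_zero]
    refine Fin.cases ?_ (fun j => ?_) j <;> simp [vecMulVec_apply, Fin.ext_iff]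
  · rw [Zmat_mul_succ]
    simp [vecMulVec_apply, Matrix.one_apply, Zmat, Fin.ext_iff, eq_comm (a := (j : ℕ))]

lemma vecMul_conjTranspose_Zmat_last (n : ℕ) :
    Pi.single (Fin.last n) 1 ᵥ* (Zmat (n + 1))ᴴ = 0 := by
  ext i
  have : (i : ℕ) ≠ n + 1 := by omega
  simp [Zmat, this]

/-- The commutator of the shift with a Toeplitz matrix is supported on the first row and the
last column. -/
lemma commutator_Zmat_toeplitz {n : ℕ} (t : ℤ → ℂ) (T : Matrix (Fin (n + 1)) (Fin (n + 1)) ℂ)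
    (hT : ∀ i j, T i j = t ((i : ℤ) - (j : ℤ))) :
    Zmat (n + 1) * T - T * Zmat (n + 1) =
      vecMulVec (Pi.single 0 1) (fun j : Fin (n + 1) => -t (-(j : ℤ) - 1)) +
        vecMulVec (fun i : Fin (n + 1) => t ((i : ℤ) - 1 - n)) (Pi.single (Fin.last n) 1) := by
  ext i j
  rw [Matrix.sub_apply, Matrix.add_apply, vecMulVec_apply, vecMulVec_apply]
  refine Fin.cases ?_ (fun i => ?_) i <;> refine Fin.lastCases ?_ (fun j => ?_) j
  · rw [Zmat_mul_zero, mul_Zmat_last]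
    simp [sub_eq_add_neg, add_comm]
  · rw [Zmat_mul_zero, mul_Zmat_castSucc, hT]
    simp [sub_eq_add_neg, add_comm]
  · rw [Zmat_mul_succ, mul_Zmat_last, hT]
    simp
  · rw [Zmat_mul_succ, mul_Zmat_castSucc, hT, hT]
    simp

/-- If the commutator of `Z` with `T` is `a vᵀ + u bᵀ`, then the commutator of `Z` with a polynomial
in `T` is generated by the Krylov vectors of `a` and of `b`. -/
lemma exists_commutator_aeval_eq {n : ℕ} {Z T : Matrix (Fin n) (Fin n) ℂ} {a b u v : Fin n → ℂ}
    (h : Z * T - T * Z = vecMulVec a v + vecMulVec u b) (s : ℕ) (p : Polynomial ℂ)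
    (hp : p.natDegree ≤ s) :
    ∃ w g : ℕ → Fin n → ℂ, Z * Polynomial.aeval T p - Polynomial.aeval T p * Z =
      ∑ i ∈ Finset.range s, vecMulVec (T ^ i *ᵥ a) (w i) +
        ∑ i ∈ Finset.range s, vecMulVec (g i) (b ᵥ* T ^ i) := by
  induction s generalizing p with
  | zero =>
    rw [Polynomial.eq_C_of_natDegree_le_zero hp]
    refine ⟨0, 0, ?_⟩
    rw [Polynomial.aeval_C, Algebra.commutes]
    simp
  | succ s ih =>
    have hq : p.divX.natDegree ≤ s := by
      rw [Polynomial.natDegree_divX_eq_natDegree_tsub_one]; omega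
    obtain ⟨w, g, hwg⟩ := ih p.divX hq
    set Q := Polynomial.aeval T p.divX with hQ
    have hpT : Polynomial.aeval T p = T * Q + algebraMap ℂ _ (p.coeff 0) := by
      conv_lhs => rw [← Polynomial.X_mul_divX_add p]
      rw [map_add, map_mul, Polynomial.aeval_X, Polynomial.aeval_C]
    have hbQ : vecMulVec u b * Q =
        ∑ i ∈ Finset.range (s + 1), vecMulVec (p.divX.coeff i • u) (b ᵥ* T ^ i) := by
      rw [hQ, Polynomial.aeval_eq_sum_range' (Nat.lt_succ_of_le hq), Finset.mul_sum]
      refine Finset.sum_congr rfl fun i _ => ?_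
      rw [mul_smul_comm, vecMulVec_mul, smul_vecMulVec]
    refine ⟨fun i => if i = 0 then v ᵥ* Q else w (i - 1),
      fun i => p.divX.coeff i • u + if i < s then T *ᵥ g i else 0, ?_⟩
    have hcomm : Z * Polynomial.aeval T p - Polynomial.aeval T p * Z =
        (Z * T - T * Z) * Q + T * (Z * Q - Q * Z) := by
      rw [hpT, mul_add, add_mul, Algebra.commutes]
      noncomm_ring
    have hg : ∑ i ∈ Finset.range (s + 1),
        vecMulVec (if i < s then T *ᵥ g i else 0) (b ᵥ* T ^ i) =
        ∑ i ∈ Finset.range s, vecMulVec (T *ᵥ g i) (b ᵥ* T ^ i) := by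
      rw [Finset.sum_range_succ]
      simp only [lt_irrefl, if_false, zero_vecMulVec, add_zero]
      exact Finset.sum_congr rfl fun i hi => by rw [if_pos (Finset.mem_range.1 hi)]
    simp only [add_vecMulVec, Finset.sum_add_distrib]
    rw [hcomm, h, hwg, hg, ← hbQ, Finset.sum_range_succ', add_mul, mul_add, Finset.mul_sum,
      Finset.mul_sum, vecMulVec_mul]
    simp only [mul_vecMulVec, mulVec_mulVec, ← pow_succ', pow_zero, one_mulVec, Nat.succ_ne_zero,
      if_true, if_false, Nat.add_sub_cancel]
    abel

/-- A polynomial of degree at most `s` of a Toeplitz matrix has displacement rank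
at most `2s`. -/
theorem toeplitz_polynomial_displacement_rank (n s : ℕ) (hs : 1 ≤ s) (t : ℤ → ℂ)
    (T : Matrix (Fin n) (Fin n) ℂ)
    (hT : ∀ i j, T i j = t ((i : ℤ) - (j : ℤ)))
    (p : Polynomial ℂ) (hp : p.natDegree ≤ s) :
    (disp (Polynomial.aeval T p)).rank ≤ 2 * s := by
  rcases n with _ | n
  · exact (rank_le_width _).trans (Nat.zero_le _)
  obtain ⟨s, rfl⟩ := Nat.exists_eq_succ_of_ne_zero (Nat.one_le_iff_ne_zero.1 hs)
  obtain ⟨w, g, hwg⟩ := exists_commutator_aeval_eq (commutator_Zmat_toeplitz t T hT) _ p hp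
  set A := Polynomial.aeval T p
  set e : Fin (n + 1) → ℂ := Pi.single 0 1
  set Z := Zmat (n + 1)
  have hdisp : disp A = vecMulVec (A *ᵥ e) e - (Z * A - A * Z) * Zᴴ := by
    rw [← mul_vecMulVec, sub_mul, Matrix.mul_assoc A, Zmat_mul_conjTranspose, disp]
    noncomm_ring
  have hsplit : disp A = vecMulVec (A *ᵥ e) e +
      ∑ i ∈ Finset.range (s + 1), vecMulVec (T ^ i *ᵥ e) (-(w i ᵥ* Zᴴ)) +
      ∑ i ∈ Finset.range s, vecMulVec (g (i + 1))
        (-(Pi.single (Fin.last n) 1 ᵥ* T ^ (i + 1) ᵥ* Zᴴ)) := by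
    rw [hdisp, hwg, add_mul, Finset.sum_mul, Finset.sum_mul]
    simp only [vecMulVec_mul]
    rw [Finset.sum_range_succ' (fun i => vecMulVec (g i) _), pow_zero, vecMul_one,
      vecMul_conjTranspose_Zmat_last]
    simp only [vecMulVec_neg, vecMulVec_zero, Finset.sum_neg_distrib]
    abel
  rw [hsplit]
  have h₁ := rank_vecMulVec_le (A *ᵥ e) e
  have h₂ := rank_sum_vecMulVec_le (s + 1) (fun i => T ^ i *ᵥ e) (fun i => -(w i ᵥ* Zᴴ))
  have h₃ := rank_sum_vecMulVec_le s (fun i => g (i + 1))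
    (fun i => -(Pi.single (Fin.last n) 1 ᵥ* T ^ (i + 1) ᵥ* Zᴴ))
  refine (rank_add_le_rank_add_rank _ _).trans
    ((Nat.add_le_add_right (rank_add_le_rank_add_rank _ _) _).trans ?_)
  omega

end
end

section
/- Let G, B ∈ ℂ^{n×r} with columns g₁, …, g_r and b₁, …, b_r respectively. Then Σ_{k=0}^{n−1} Z^k (G Bᴴ) (Zᴴ)^k = Σ_{j=1}^{r} L(g_j) · U(b_jᴴ), where for x ∈ ℂⁿ, L(x) denotes the lower triangular Toeplitz matrix whose first column is x, and for a row vector y ∈ ℂ^{1×n}, U(y) denotes the upper triangular Toeplitz matrix whose first row is y (here b_jᴴ is the conjugate-transposed row of the column b_j). -/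
open Matrix

noncomputable section

/-- The lower triangular Toeplitz matrix whose first column is `x`. -/
def Lmat {n : ℕ} (x : Fin n → ℂ) : Matrix (Fin n) (Fin n) ℂ :=
  Matrix.of fun i j =>
    if (j : ℕ) ≤ (i : ℕ) then
      x ⟨(i : ℕ) - (j : ℕ), lt_of_le_of_lt (Nat.sub_le _ _) i.isLt⟩
    else 0

/-- The upper triangular Toeplitz matrix whose first row is `y`. -/
def Umat {n : ℕ} (y : Fin n → ℂ) : Matrix (Fin n) (Fin n) ℂ :=
  Matrix.of fun i j =>
    if (i : ℕ) ≤ (j : ℕ) then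
      y ⟨(j : ℕ) - (i : ℕ), lt_of_le_of_lt (Nat.sub_le _ _) j.isLt⟩
    else 0

theorem Zmat_mul_apply {n : ℕ} {m : Type*} (M : Matrix (Fin n) m ℂ) (i : Fin n) (j : m) :
    (Zmat n * M) i j =
      if 1 ≤ (i : ℕ) then M ⟨i - 1, lt_of_le_of_lt (Nat.sub_le _ _) i.isLt⟩ j else 0 := by
  simp only [Matrix.mul_apply, Zmat, Matrix.of_apply, ite_mul, one_mul, zero_mul]
  split_ifs with hi
  · rw [Finset.sum_eq_single ⟨i - 1, lt_of_le_of_lt (Nat.sub_le _ _) i.isLt⟩]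
    · exact if_pos (by simp only; omega)
    · intro l _ hl
      refine if_neg fun h => hl (Fin.ext ?_)
      simp only
      omega
    · simp
  · exact Finset.sum_eq_zero fun l _ => if_neg (by omega)

/-- Multiplication by `Z ^ k` shifts the rows down by `k`. -/
theorem Zmat_pow_mul_apply {n : ℕ} {m : Type*} (M : Matrix (Fin n) m ℂ) (k : ℕ) (i : Fin n)
    (j : m) :
    (Zmat n ^ k * M) i j =
      if k ≤ (i : ℕ) then M ⟨i - k, lt_of_le_of_lt (Nat.sub_le _ _) i.isLt⟩ j else 0 := by
  induction k generalizing i with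
  | zero => simp
  | succ k ih =>
    rw [pow_succ', Matrix.mul_assoc, Zmat_mul_apply, ih]
    simp only
    split_ifs <;> first | omega | rfl | (congr 2; omega)

theorem Lmat_apply_eq_Zmat_pow_mul {n r : ℕ} (G : Matrix (Fin n) (Fin r) ℂ) (i k : Fin n)
    (j : Fin r) : Lmat (fun i => G i j) i k = (Zmat n ^ (k : ℕ) * G) i j := by
  rw [Zmat_pow_mul_apply, Lmat, Matrix.of_apply]

theorem Umat_apply_eq_star_Zmat_pow_mul {n r : ℕ} (B : Matrix (Fin n) (Fin r) ℂ) (k l : Fin n)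
    (j : Fin r) : Umat (fun i => star (B i j)) k l = star ((Zmat n ^ (k : ℕ) * B) l j) := by
  rw [Zmat_pow_mul_apply, Umat, Matrix.of_apply]
  split_ifs <;> simp

/-- Reconstruction from a generator as a sum of products of triangular Toeplitz matrices:
`Σ_{k=0}^{n-1} Z^k (G Bᴴ) (Zᴴ)^k = Σ_{j=1}^{r} L(g_j) U(b_jᴴ)`. -/
theorem reconstruction_triangular_toeplitz (n r : ℕ)
    (G B : Matrix (Fin n) (Fin r) ℂ) :
    ∑ k ∈ Finset.range n, Zmat n ^ k * (G * Bᴴ) * ((Zmat n)ᴴ) ^ k =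
      ∑ j : Fin r, Lmat (fun i => G i j) * Umat (fun i => star (B i j)) := by
  have factor (k : ℕ) : Zmat n ^ k * (G * Bᴴ) * ((Zmat n)ᴴ) ^ k =
      (Zmat n ^ k * G) * (Zmat n ^ k * B)ᴴ := by
    simp only [Matrix.conjTranspose_mul, Matrix.conjTranspose_pow, Matrix.mul_assoc]
  ext i l
  simp only [factor, Matrix.sum_apply, Matrix.mul_apply (M := Lmat _),
    Lmat_apply_eq_Zmat_pow_mul, Umat_apply_eq_star_Zmat_pow_mul]
  rw [Finset.sum_comm, Finset.sum_range]
  simp only [Matrix.mul_apply (N := (_)ᴴ), Matrix.conjTranspose_apply]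

end
end
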